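/- arXiv:1603.01212 — 2 statements merged into one kernel-verified Lean document; each statement's English description precedes it below -/
import Mathlib

section
/- Let f : ℝ² → ℝ be a continuous function with support contained in the closed ball of radius R > 0 centered at the origin. Then for every t ≥ 2√2·R and every x ∈ ℝ² with ‖x‖ ≤ R, one has |(1/(2π)) ∫_{{y : ‖y−x‖ < t}} f(y)/√(t² − ‖y−x‖²) dy| ≤ (R² · sup_{y∈ℝ²} |f(y)|)/t. -/
open MeasureTheory Real

noncomputable abbrev E2 := EuclideanSpace ℝ (Fin 2)

/-- For continuous `f` supported in the closed ball of radius `R > 0` about the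
origin, every `t ≥ 2√2·R` and every `x` with `‖x‖ ≤ R`,
`|(1/(2π)) ∫_{‖y-x‖<t} f(y)/√(t²-‖y-x‖²) dy| ≤ R² · (sup |f|) / t`. -/
theorem stmt2 (R : ℝ) (hR : 0 < R) (f : E2 → ℝ) (hf : Continuous f)
    (hsupp : Function.support f ⊆ Metric.closedBall 0 R)
    (t : ℝ) (ht : 2 * Real.sqrt 2 * R ≤ t) (x : E2) (hx : ‖x‖ ≤ R) :
    |(1 / (2 * π)) * ∫ y in Metric.ball x t, f y / Real.sqrt (t ^ 2 - ‖y - x‖ ^ 2)|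
      ≤ R ^ 2 * (⨆ y : E2, |f y|) / t := by
  have hs2 : Real.sqrt 2 ^ 2 = 2 := Real.sq_sqrt (by norm_num)
  have hs1 : 1 ≤ Real.sqrt 2 := Real.one_le_sqrt.mpr (by norm_num)
  have ht2 : 2 * R ≤ t := by nlinarith
  have ht8 : 8 * R ^ 2 ≤ t ^ 2 := by
    have h := pow_le_pow_left₀ (by positivity) ht 2
    have e : (2 * Real.sqrt 2 * R) ^ 2 = 8 * R ^ 2 := by
      rw [mul_pow, mul_pow, hs2]; ring
    linarith
  have htlt : 2 * R < t := by
    rcases lt_or_eq_of_le ht2 with h | h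
    · exact h
    · subst h; nlinarith [pow_pos hR 2]
  have htpos : 0 < t := by linarith
  have hdist : ∀ y ∈ Metric.closedBall (0 : E2) R, ‖y - x‖ ≤ 2 * R := by
    intro y hy
    rw [mem_closedBall_zero_iff] at hy
    linarith [norm_sub_le y x]
  have hsub : Metric.closedBall (0 : E2) R ⊆ Metric.ball x t := by
    intro y hy
    rw [mem_ball_iff_norm]
    exact lt_of_le_of_lt (hdist y hy) htlt
  have hcs : HasCompactSupport f :=
    HasCompactSupport.of_support_subset_isCompact (isCompact_closedBall 0 R) hsupp
  obtain ⟨C, hC⟩ := hcs.exists_bound_of_continuous hf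
  have hbdd : BddAbove (Set.range fun y : E2 => |f y|) := by
    refine ⟨C, ?_⟩
    rintro _ ⟨y, rfl⟩
    exact hC y
  set M := ⨆ y : E2, |f y| with hM
  have hle : ∀ y, |f y| ≤ M := fun y => le_ciSup hbdd y
  have hM0 : 0 ≤ M := (abs_nonneg _).trans (hle 0)
  have hint : ∫ y in Metric.ball x t, f y / Real.sqrt (t ^ 2 - ‖y - x‖ ^ 2)
      = ∫ y in Metric.closedBall (0 : E2) R, f y / Real.sqrt (t ^ 2 - ‖y - x‖ ^ 2) := by
    apply setIntegral_eq_of_subset_of_forall_sdiff_eq_zero Metric.isOpen_ball.measurableSet hsub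
    intro y hy
    have : f y = 0 := by
      by_contra h
      exact hy.2 (hsupp h)
    simp [this]
  have hvol : volume.real (Metric.closedBall (0 : E2) R) = π * R ^ 2 := by
    rw [measureReal_def, EuclideanSpace.volume_closedBall]
    have hG : Real.Gamma (1 + 1) = 1 := by
      rw [one_add_one_eq_two]; exact Real.Gamma_two
    simp [ENNReal.toReal_ofReal, hR.le, pi_pos.le, Real.sq_sqrt, hG]
    ring
  have hb : ‖∫ y in Metric.closedBall (0 : E2) R, f y / Real.sqrt (t ^ 2 - ‖y - x‖ ^ 2)‖
      ≤ (M * (2 / t)) * volume.real (Metric.closedBall (0 : E2) R) := by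
    apply norm_setIntegral_le_of_norm_le_const measure_closedBall_lt_top
    intro y hy
    have h1 := hdist y hy
    have h2 : ‖y - x‖ ^ 2 ≤ (2 * R) ^ 2 := pow_le_pow_left₀ (norm_nonneg _) h1 2
    have h3 : t / 2 ≤ Real.sqrt (t ^ 2 - ‖y - x‖ ^ 2) := by
      apply Real.le_sqrt_of_sq_le
      nlinarith
    rw [norm_div, Real.norm_eq_abs, Real.norm_eq_abs, abs_of_nonneg (Real.sqrt_nonneg _)]
    calc |f y| / Real.sqrt (t ^ 2 - ‖y - x‖ ^ 2) ≤ M / (t / 2) :=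
          div_le_div₀ hM0 (hle y) (by positivity) h3
      _ = M * (2 / t) := by field_simp
  rw [hint, abs_mul, abs_of_pos (by positivity : 0 < 1 / (2 * π))]
  rw [Real.norm_eq_abs, hvol] at hb
  calc _ ≤ 1 / (2 * π) * ((M * (2 / t)) * (π * R ^ 2)) := by gcongr
    _ = R ^ 2 * M / t := by
      have := pi_pos.ne'
      field_simp
end

section
/- C¹ bound via Sobolev norms for solutions of the two-dimensional wave equation: for every ρ > 0 there exists a constant C > 0, depending only on ρ, with the following property. Let T > 0 and let w : ℝ × ℝ² → ℝ be a smooth (C^∞) function satisfying ∂²_t w(t,x) = ∂²_{x₁} w(t,x) + ∂²_{x₂} w(t,x) for all (t,x), such that for every t ∈ [0,T] the support of w(t,·) is contained in the closed ball of radius ρ centered at the origin. Then for every t ∈ [0,T] and every x ∈ ℝ², |w(t,x)| + ‖∇_x w(t,x)‖ ≤ C · [ ( Σ_{k=0}^{3} ∫_{ℝ²} ‖D^k_x w(0,·)(y)‖² dy )^{1/2} + ( Σ_{k=0}^{2} ∫_{ℝ²} ‖D^k_x (∂_t w)(0,·)(y)‖² dy )^{1/2} ]. -/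
open MeasureTheory Real

namespace Wav

abbrev P3 := Fin 3 → ℝ

noncomputable def D (i : Fin 3) (f : P3 → ℝ) : P3 → ℝ := fun p => fderiv ℝ f p (Pi.single i 1)

abbrev Sm (f : P3 → ℝ) : Prop := ContDiff ℝ (⊤ : ℕ∞) f

lemma Sm.D {f : P3 → ℝ} (hf : Sm f) (i : Fin 3) : Sm (D i f) := by
  unfold Wav.D
  have : ContDiff ℝ (⊤ : ℕ∞) (fderiv ℝ f) := hf.fderiv_right (by simp)
  exact this.clm_apply contDiff_const

lemma Sm.diff {f : P3 → ℝ} (hf : Sm f) : Differentiable ℝ f := hf.differentiable (by simp)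

lemma D_comm {f : P3 → ℝ} (hf : Sm f) (i j : Fin 3) : D i (D j f) = D j (D i f) := by
  funext p
  have h2 : ContDiff ℝ (⊤ : ℕ∞) (fderiv ℝ f) := hf.fderiv_right (by simp)
  have hd : DifferentiableAt ℝ (fderiv ℝ f) p := (h2.differentiable (by simp)) p
  have hs : IsSymmSndFDerivAt ℝ f p := ((contDiff_infty.1 hf) 2).contDiffAt.isSymmSndFDerivAt (by simp)
  unfold D
  rw [fderiv_clm_apply hd (by fun_prop), fderiv_clm_apply hd (by fun_prop)]
  simpa using hs _ _

lemma D_add {f g : P3 → ℝ} (hf : Sm f) (hg : Sm g) (i : Fin 3) :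
    D i (f + g) = D i f + D i g := by
  funext p
  simp [D, fderiv_add (hf.diff p) (hg.diff p)]

lemma hasDeriv0 {G : P3 → ℝ} (hG : Sm G) (t a b : ℝ) :
    HasDerivAt (fun s => G ![s, a, b]) (D 0 G ![t, a, b]) t := by
  have h1 : HasDerivAt (fun s : ℝ => ![s, a, b]) (Pi.single (0 : Fin 3) (1:ℝ)) t := by
    rw [hasDerivAt_pi]
    intro i
    fin_cases i
    · simpa using hasDerivAt_id' t
    · simpa using hasDerivAt_const t a
    · simpa using hasDerivAt_const t b
  exact (hG.diff ![t, a, b]).hasFDerivAt.comp_hasDerivAt t h1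

lemma hasDeriv1 {G : P3 → ℝ} (hG : Sm G) (t a b : ℝ) :
    HasDerivAt (fun s => G ![t, s, b]) (D 1 G ![t, a, b]) a := by
  have h1 : HasDerivAt (fun s : ℝ => ![t, s, b]) (Pi.single (1 : Fin 3) (1:ℝ)) a := by
    rw [hasDerivAt_pi]
    intro i
    fin_cases i
    · simpa using hasDerivAt_const a t
    · simpa using hasDerivAt_id' a
    · simpa using hasDerivAt_const a b
  exact (hG.diff ![t, a, b]).hasFDerivAt.comp_hasDerivAt a h1

lemma hasDeriv2 {G : P3 → ℝ} (hG : Sm G) (t a b : ℝ) :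
    HasDerivAt (fun s => G ![t, a, s]) (D 2 G ![t, a, b]) b := by
  have h1 : HasDerivAt (fun s : ℝ => ![t, a, s]) (Pi.single (2 : Fin 3) (1:ℝ)) b := by
    rw [hasDerivAt_pi]
    intro i
    fin_cases i
    · simpa using hasDerivAt_const b t
    · simpa using hasDerivAt_const b a
    · simpa using hasDerivAt_id' b
  exact (hG.diff ![t, a, b]).hasFDerivAt.comp_hasDerivAt b h1

abbrev box (R : ℝ) : Set (Fin 2 → ℝ) := Set.Icc (fun _ => -R) (fun _ => R)

noncomputable def en (V : P3 → ℝ) : P3 → ℝ :=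
  fun p => (D 0 V p) ^ 2 + (D 1 V p) ^ 2 + (D 2 V p) ^ 2

lemma energy {V : P3 → ℝ} (hV : Sm V)
    (hw : ∀ p, D 0 (D 0 V) p = D 1 (D 1 V) p + D 2 (D 2 V) p) {R t : ℝ} (hR : 0 < R) (ht : 0 ≤ t)
    (hb : ∀ s ∈ Set.Icc 0 t, ∀ a b : ℝ, (|a| = R ∨ |b| = R) →
      D 1 V ![s, a, b] = 0 ∧ D 2 V ![s, a, b] = 0) :
    ∫ p in box R, en V ![t, p 0, p 1] = ∫ p in box R, en V ![0, p 0, p 1] := by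
  have d0 := (hV.D 0).diff
  have d1 := (hV.D 1).diff
  have d2 := (hV.D 2).diff
  let f : Fin 3 → P3 → ℝ := ![en V, fun p => -2 * (D 0 V p * D 1 V p),
    fun p => -2 * (D 0 V p * D 2 V p)]
  have hf : ∀ i, Differentiable ℝ (f i) := by
    intro i
    fin_cases i
    · change Differentiable ℝ (en V)
      unfold en
      fun_prop
    · change Differentiable ℝ (fun p => -2 * (D 0 V p * D 1 V p))
      fun_prop
    · change Differentiable ℝ (fun p => -2 * (D 0 V p * D 2 V p))
      fun_prop
  have hdiv : ∀ x, ∑ i, fderiv ℝ (f i) x (Pi.single i 1) = 0 := by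
    intro x
    have h0 := (d0 x).hasFDerivAt
    have h1 := (d1 x).hasFDerivAt
    have h2 := (d2 x).hasFDerivAt
    have e0 : HasFDerivAt (f 0) _ x := ((h0.pow 2).add (h1.pow 2)).add (h2.pow 2)
    have e1 : HasFDerivAt (f 1) _ x := (h0.mul h1).const_mul (-2)
    have e2 : HasFDerivAt (f 2) _ x := (h0.mul h2).const_mul (-2)
    rw [Fin.sum_univ_three, e0.fderiv, e1.fderiv, e2.fderiv]
    have c1 := congrFun (D_comm hV 0 1) x
    have c2 := congrFun (D_comm hV 0 2) x
    have hwx := hw x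
    simp only [D] at c1 c2 hwx ⊢
    simp
    rw [c1, c2, hwx]
    ring
  have key := integral_divergence_of_hasFDerivAt_off_countable' (![0, -R, -R] : P3) ![t, R, R]
    (by intro i; fin_cases i <;> simp <;> linarith) f (fun i x => fderiv ℝ (f i) x) ∅
    Set.countable_empty (fun i => (hf i).continuous.continuousOn)
    (fun x _ i => (hf i x).hasFDerivAt) (by simp only [hdiv]; simp)
  simp only [hdiv, integral_zero] at key
  rw [Fin.sum_univ_three] at key
  have k1 : ∀ c : ℝ, |c| = R → ∫ x in Set.Icc ((![0, -R, -R] : P3) ∘ Fin.succAbove 1)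
      ((![t, R, R] : P3) ∘ Fin.succAbove 1), f 1 (Fin.insertNth 1 c x) = 0 := by
    intro c hc
    refine setIntegral_eq_zero_of_forall_eq_zero ?_
    intro x hx
    have : (Fin.insertNth 1 c x : P3) = ![x 0, c, x 1] := by
      ext i; fin_cases i <;> rfl
    rw [this]
    have h0 : x 0 ∈ Set.Icc 0 t := ⟨hx.1 0, hx.2 0⟩
    change -2 * (D 0 V _ * D 1 V _) = 0
    rw [(hb _ h0 c (x 1) (Or.inl hc)).1]; simp
  have k2 : ∀ c : ℝ, |c| = R → ∫ x in Set.Icc ((![0, -R, -R] : P3) ∘ Fin.succAbove 2)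
      ((![t, R, R] : P3) ∘ Fin.succAbove 2), f 2 (Fin.insertNth 2 c x) = 0 := by
    intro c hc
    refine setIntegral_eq_zero_of_forall_eq_zero ?_
    intro x hx
    have : (Fin.insertNth 2 c x : P3) = ![x 0, x 1, c] := by
      ext i; fin_cases i <;> rfl
    rw [this]
    have h0 : x 0 ∈ Set.Icc 0 t := ⟨hx.1 0, hx.2 0⟩
    change -2 * (D 0 V _ * D 2 V _) = 0
    rw [(hb _ h0 (x 1) c (Or.inr hc)).2]; simp
  have k0 : ∀ c : ℝ, ∫ x in Set.Icc ((![0, -R, -R] : P3) ∘ Fin.succAbove 0)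
      ((![t, R, R] : P3) ∘ Fin.succAbove 0), f 0 (Fin.insertNth 0 c x)
      = ∫ p in box R, en V ![c, p 0, p 1] := by
    intro c
    have e1 : ((![0, -R, -R] : P3) ∘ Fin.succAbove 0) = fun _ => -R := by
      ext i; fin_cases i <;> rfl
    have e2 : ((![t, R, R] : P3) ∘ Fin.succAbove 0) = fun _ => R := by
      ext i; fin_cases i <;> rfl
    rw [e1, e2]
    congr 1
    funext x
    have : (Fin.insertNth 0 c x : P3) = ![c, x 0, x 1] := by
      ext i; fin_cases i <;> rfl
    rw [this]; rfl
  have hRR : |R| = R := abs_of_pos hR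
  have hRR' : |-R| = R := by rw [abs_neg, hRR]
  have m1 := k1 R hRR
  have m2 := k1 (-R) hRR'
  have m3 := k2 R hRR
  have m4 := k2 (-R) hRR'
  have m5 := k0 t
  have m6 := k0 0
  simp only [Matrix.cons_val] at key
  rw [m1, m2, m3, m4, m5, m6] at key
  linarith

lemma sob1 {f f' : ℝ → ℝ} (hf : ∀ x, HasDerivAt f (f' x) x) (hc : Continuous f') {R : ℝ}
    (hR : 0 < R) (h0 : f (-R) = 0) {x : ℝ} (hx : x ∈ Set.Icc (-R) R) :
    f x ^ 2 ≤ 2 * R * ∫ s in (-R)..R, f' s ^ 2 := by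
  have hi : ∀ a b : ℝ, IntervalIntegrable f' volume a b := fun a b => hc.intervalIntegrable a b
  have hi2 : ∀ a b : ℝ, IntervalIntegrable (fun s => f' s ^ 2) volume a b :=
    fun a b => (hc.pow 2).intervalIntegrable a b
  have ftc : ∫ s in (-R)..x, f' s = f x := by
    rw [intervalIntegral.integral_eq_sub_of_hasDerivAt (fun s _ => hf s) (hi _ _), h0, sub_zero]
  set c := f x / (2 * R) with hcdef
  have hfx : f x = c * (2 * R) := by rw [hcdef]; field_simp
  have p1 : 0 ≤ ∫ s in (-R)..x, (f' s - c) ^ 2 :=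
    intervalIntegral.integral_nonneg hx.1 (fun s _ => sq_nonneg _)
  have p2 : ∫ s in (-R)..x, (f' s - c) ^ 2
      = (∫ s in (-R)..x, f' s ^ 2) - 2 * c * f x + c ^ 2 * (x + R) := by
    have : ∀ s, (f' s - c) ^ 2 = (f' s ^ 2 - (2 * c) * f' s) + c ^ 2 := fun s => by ring
    simp only [this]
    rw [intervalIntegral.integral_add ((hi2 _ _).sub ((hi _ _).const_mul _)) (by simp),
      intervalIntegral.integral_sub (hi2 _ _) ((hi _ _).const_mul _),
      intervalIntegral.integral_const_mul, ftc]
    simp; ring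
  have p3 : ∫ s in (-R)..x, f' s ^ 2 ≤ ∫ s in (-R)..R, f' s ^ 2 := by
    have := intervalIntegral.integral_add_adjacent_intervals (hi2 (-R) x) (hi2 x R)
    have h4 : 0 ≤ ∫ s in x..R, f' s ^ 2 :=
      intervalIntegral.integral_nonneg hx.2 (fun s _ => sq_nonneg _)
    linarith
  have p4 : c ^ 2 * (x + R) ≤ c ^ 2 * (2 * R) := by
    apply mul_le_mul_of_nonneg_left _ (sq_nonneg c); linarith [hx.2]
  have p5 : c ^ 2 * (2 * R) ≤ ∫ s in (-R)..R, f' s ^ 2 := by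
    rw [hfx] at p2; nlinarith
  calc f x ^ 2 = 2 * R * (c ^ 2 * (2 * R)) := by rw [hfx]; ring
    _ ≤ _ := by gcongr

lemma box_integral {h : ℝ → ℝ → ℝ} (hc : Continuous (Function.uncurry h)) {R : ℝ} (hR : 0 < R) :
    ∫ p in box R, h (p 0) (p 1) = ∫ s in (-R)..R, ∫ r in (-R)..R, h s r := by
  have hmp := volume_preserving_finTwoArrow ℝ
  have h1 := hmp.setIntegral_preimage_emb MeasurableEquiv.finTwoArrow.measurableEmbedding
    (Function.uncurry h) (Set.Icc (-R) R ×ˢ Set.Icc (-R) R)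
  have hpre : (MeasurableEquiv.finTwoArrow : (Fin 2 → ℝ) ≃ᵐ ℝ × ℝ) ⁻¹'
      (Set.Icc (-R) R ×ˢ Set.Icc (-R) R) = box R := by
    ext p
    simp [MeasurableEquiv.finTwoArrow, Pi.le_def, Fin.forall_fin_two]
  rw [hpre] at h1
  have h2 : ∫ p in box R, h (p 0) (p 1) = ∫ x in box R, Function.uncurry h
      (MeasurableEquiv.finTwoArrow x) := rfl
  rw [h2, h1, Measure.volume_eq_prod, setIntegral_prod]
  · rw [intervalIntegral.integral_of_le (by linarith), integral_Icc_eq_integral_Ioc]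
    congr 1
    funext s
    rw [intervalIntegral.integral_of_le (by linarith), integral_Icc_eq_integral_Ioc]
    rfl
  · exact hc.continuousOn.integrableOn_compact (isCompact_Icc.prod isCompact_Icc)

lemma sob2 {G : P3 → ℝ} (hG : Sm G) {R t : ℝ} (hR : 0 < R)
    (hb : ∀ a b : ℝ, (|a| = R ∨ |b| = R) → G ![t, a, b] = 0 ∧ D 1 G ![t, a, b] = 0)
    {a b : ℝ} (ha : a ∈ Set.Icc (-R) R) (hb' : b ∈ Set.Icc (-R) R) :
    G ![t, a, b] ^ 2 ≤ (2 * R) ^ 2 * ∫ p in box R, D 2 (D 1 G) ![t, p 0, p 1] ^ 2 := by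
  have hRR' : |-R| = R := by rw [abs_neg, abs_of_pos hR]
  have cc1 := (hG.D 1).continuous
  have cc2 := ((hG.D 1).D 2).continuous
  have h1 := sob1 (fun s => hasDeriv1 hG t s b) (by fun_prop) hR (hb _ _ (Or.inl hRR')).1 ha
  have h2 : ∀ s, D 1 G ![t, s, b] ^ 2 ≤ 2 * R * ∫ r in (-R)..R, D 2 (D 1 G) ![t, s, r] ^ 2 :=
    fun s => sob1 (fun r => hasDeriv2 (hG.D 1) t s r) (by fun_prop) hR
      (hb _ _ (Or.inr hRR')).2 hb'
  have hu : Continuous (Function.uncurry fun s r : ℝ => D 2 (D 1 G) ![t, s, r] ^ 2) := by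
    change Continuous (fun z : ℝ × ℝ => D 2 (D 1 G) ![t, z.1, z.2] ^ 2)
    fun_prop
  rw [box_integral (h := fun s r => D 2 (D 1 G) ![t, s, r] ^ 2) hu hR]
  have h3 : ∫ s in (-R)..R, D 1 G ![t, s, b] ^ 2 ≤
      ∫ s in (-R)..R, 2 * R * ∫ r in (-R)..R, D 2 (D 1 G) ![t, s, r] ^ 2 := by
    apply intervalIntegral.integral_mono_on (by linarith)
    · exact Continuous.intervalIntegrable (by fun_prop) _ _
    · apply Continuous.intervalIntegrable
      exact (intervalIntegral.continuous_parametric_intervalIntegral_of_continuous' hu _ _).const_mul _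
    · exact fun s _ => h2 s
  rw [intervalIntegral.integral_const_mul] at h3
  calc _ ≤ _ := h1
    _ ≤ 2 * R * (2 * R * ∫ s in (-R)..R, ∫ r in (-R)..R, D 2 (D 1 G) ![t, s, r] ^ 2) := by gcongr
    _ = _ := by ring

noncomputable abbrev ev (i : Fin 2) : E2 := EuclideanSpace.single i (1 : ℝ)

lemma slice {G : P3 → ℝ} (hG : Sm G) (t : ℝ) (z : E2) (i : Fin 2) :
    fderiv ℝ (fun z : E2 => G ![t, z 0, z 1]) z (ev i) = D i.succ G ![t, z 0, z 1] := by
  let L : E2 →L[ℝ] P3 := ContinuousLinearMap.pi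
    ![0, EuclideanSpace.proj (0 : Fin 2), EuclideanSpace.proj (1 : Fin 2)]
  have h1 : HasFDerivAt (fun z : E2 => (![t, z 0, z 1] : P3)) L z := by
    rw [hasFDerivAt_pi']
    intro j
    fin_cases j
    · exact hasFDerivAt_const t z
    · exact (EuclideanSpace.proj (0 : Fin 2) : E2 →L[ℝ] ℝ).hasFDerivAt
    · exact (EuclideanSpace.proj (1 : Fin 2) : E2 →L[ℝ] ℝ).hasFDerivAt
  have h2 := (hG.diff ![t, z 0, z 1]).hasFDerivAt.comp z h1
  have h3 : fderiv ℝ (fun z : E2 => G ![t, z 0, z 1]) z = _ := h2.fderiv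
  rw [h3]
  have h4 : L (ev i) = Pi.single i.succ 1 := by
    ext j
    fin_cases i <;> fin_cases j <;> simp [L, ev, Pi.single_apply]
  simp only [ContinuousLinearMap.comp_apply, h4]
  rfl

lemma slice_smooth {G : P3 → ℝ} (hG : Sm G) (t : ℝ) :
    ContDiff ℝ (⊤ : ℕ∞) (fun z : E2 => G ![t, z 0, z 1]) := by
  refine hG.comp ?_
  rw [contDiff_pi]
  intro j
  fin_cases j
  · exact contDiff_const
  · exact (EuclideanSpace.proj (0 : Fin 2) : E2 →L[ℝ] ℝ).contDiff
  · exact (EuclideanSpace.proj (1 : Fin 2) : E2 →L[ℝ] ℝ).contDiff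

lemma van {G : P3 → ℝ} (hG : Sm G) {t ρ : ℝ} (h : ∀ z : E2, ρ < ‖z‖ → G ![t, z 0, z 1] = 0)
    (i : Fin 2) : ∀ z : E2, ρ < ‖z‖ → D i.succ G ![t, z 0, z 1] = 0 := by
  intro z hz
  rw [← slice hG]
  have : (fun z : E2 => G ![t, z 0, z 1]) =ᶠ[nhds z] fun _ => 0 := by
    filter_upwards [(isOpen_lt continuous_const continuous_norm).mem_nhds hz] with y hy
    exact h y hy
  rw [this.fderiv_eq]
  simp

lemma itstep {f : E2 → ℝ} (hf : ContDiff ℝ (⊤ : ℕ∞) f) {H : P3 → ℝ} (hH : Sm H) {t : ℝ} {n : ℕ}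
    {m : Fin n → E2} (h : ∀ y : E2, H ![t, y 0, y 1] = iteratedFDeriv ℝ n f y m) (i : Fin 2) :
    ∀ y : E2, D i.succ H ![t, y 0, y 1] =
      iteratedFDeriv ℝ (n + 1) f y (Fin.cons (ev i) m : Fin (n + 1) → E2) := by
  intro y
  rw [← slice hH, funext h, iteratedFDeriv_succ_apply_left]
  have hd : DifferentiableAt ℝ (iteratedFDeriv ℝ n f) y :=
    hf.differentiable_iteratedFDeriv (by exact_mod_cast ENat.coe_lt_top n) y
  have h2 := ((ContinuousMultilinearMap.apply ℝ (fun _ : Fin n => E2) ℝ m).hasFDerivAt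
    (x := iteratedFDeriv ℝ n f y)).comp y hd.hasFDerivAt
  have h3 : fderiv ℝ (fun y => iteratedFDeriv ℝ n f y m) y = _ := h2.fderiv
  rw [h3]
  simp

lemma itbound {f : E2 → ℝ} {n : ℕ} {m : Fin n → E2} (hm : ∀ i, ‖m i‖ ≤ 1) (y : E2) :
    (iteratedFDeriv ℝ n f y m) ^ 2 ≤ ‖iteratedFDeriv ℝ n f y‖ ^ 2 := by
  have := ContinuousMultilinearMap.unit_le_opNorm (f := iteratedFDeriv ℝ n f y) (m := m)
    ((pi_norm_le_iff_of_nonneg zero_le_one).2 hm)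
  rw [← sq_abs]
  gcongr
  simpa using this

lemma ev_norm (i : Fin 2) : ‖ev i‖ ≤ 1 := by simp [ev]

lemma bound2 {G : P3 → ℝ} (hG : Sm G) (t : ℝ) (i j : Fin 2) (y : E2) :
    D i.succ (D j.succ G) ![t, y 0, y 1] ^ 2 ≤
      ‖iteratedFDeriv ℝ 2 (fun z : E2 => G ![t, z 0, z 1]) y‖ ^ 2 := by
  have hf := slice_smooth hG t
  have h0 : ∀ y : E2, G ![t, y 0, y 1] =
    iteratedFDeriv ℝ 0 (fun z : E2 => G ![t, z 0, z 1]) y ![] := by intro y; simp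
  have h1 := itstep hf hG h0 j
  have h2 := itstep hf (hG.D j.succ) h1 i
  rw [h2]
  apply itbound
  intro k
  fin_cases k <;> exact ev_norm _

lemma bound3 {G : P3 → ℝ} (hG : Sm G) (t : ℝ) (i j k : Fin 2) (y : E2) :
    D i.succ (D j.succ (D k.succ G)) ![t, y 0, y 1] ^ 2 ≤
      ‖iteratedFDeriv ℝ 3 (fun z : E2 => G ![t, z 0, z 1]) y‖ ^ 2 := by
  have hf := slice_smooth hG t
  have h0 : ∀ y : E2, G ![t, y 0, y 1] =
    iteratedFDeriv ℝ 0 (fun z : E2 => G ![t, z 0, z 1]) y ![] := by intro y; simp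
  have h1 := itstep hf hG h0 k
  have h2 := itstep hf (hG.D k.succ) h1 j
  have h3 := itstep hf ((hG.D k.succ).D j.succ) h2 i
  rw [h3]
  apply itbound
  intro k
  fin_cases k <;> exact ev_norm _

lemma wave_D {f : P3 → ℝ} (hf : Sm f) (hw : D 0 (D 0 f) = D 1 (D 1 f) + D 2 (D 2 f)) (i : Fin 3) :
    D 0 (D 0 (D i f)) = D 1 (D 1 (D i f)) + D 2 (D 2 (D i f)) := by
  have c : ∀ j, D j (D j (D i f)) = D i (D j (D j f)) := by
    intro j
    rw [D_comm hf j i, D_comm (hf.D j) j i]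
  rw [c 0, c 1, c 2, hw, D_add ((hf.D 1).D 1) ((hf.D 2).D 2)]

lemma int_it {f : E2 → ℝ} (hf : ContDiff ℝ (⊤ : ℕ∞) f) {ρ : ℝ} (h : ∀ z : E2, ρ < ‖z‖ → f z = 0)
    (n : ℕ) : Integrable (fun y => ‖iteratedFDeriv ℝ n f y‖ ^ 2) := by
  have hc : HasCompactSupport f := by
    refine HasCompactSupport.intro (isCompact_closedBall (0 : E2) ρ) ?_
    intro x hx
    apply h
    simpa using hx
  have hcont : Continuous (iteratedFDeriv ℝ n f) :=
    hf.continuous_iteratedFDeriv (by exact_mod_cast le_top)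
  refine Continuous.integrable_of_hasCompactSupport (by fun_prop) ?_
  exact (hc.iteratedFDeriv (𝕜 := ℝ) n).comp_left (g := fun L => ‖L‖ ^ 2) (by simp)

lemma box_le {g : E2 → ℝ} (hg : Integrable g) (h0 : ∀ y, 0 ≤ g y) {F : (Fin 2 → ℝ) → ℝ}
    (hF : Continuous F) (hFg : ∀ y : E2, F (fun i => y i) ≤ g y) (R : ℝ) :
    ∫ p in box R, F p ≤ ∫ y, g y := by
  have hmp := PiLp.volume_preserving_toLp (Fin 2)
  have hemb : MeasurableEmbedding (WithLp.toLp 2 : (Fin 2 → ℝ) → E2) :=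
    (MeasurableEquiv.toLp 2 (Fin 2 → ℝ)).measurableEmbedding
  have h1 : ∫ p : Fin 2 → ℝ, g (WithLp.toLp 2 p) = ∫ y, g y := hmp.integral_comp hemb g
  have h2 : Integrable (fun p : Fin 2 → ℝ => g (WithLp.toLp 2 p)) :=
    (hmp.integrable_comp_emb hemb).2 hg
  rw [← h1]
  calc ∫ p in box R, F p ≤ ∫ p in box R, g (WithLp.toLp 2 p) := by
        apply setIntegral_mono (hF.continuousOn.integrableOn_compact isCompact_Icc) h2.integrableOn
        intro p
        exact hFg (WithLp.toLp 2 p)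
    _ ≤ _ := setIntegral_le_integral h2 (Filter.Eventually.of_forall fun p => h0 _)

lemma grad_le (f : E2 → ℝ) (x : E2) :
    ‖gradient f x‖ ≤ |fderiv ℝ f x (ev 0)| + |fderiv ℝ f x (ev 1)| := by
  rw [gradient, LinearIsometryEquiv.norm_map]
  apply ContinuousLinearMap.opNorm_le_bound _ (by positivity)
  intro v
  have hv : v = v 0 • ev 0 + v 1 • ev 1 := by
    ext i; fin_cases i <;> simp [ev]
  have b0 : |v 0| ≤ ‖v‖ := PiLp.norm_apply_le v 0
  have b1 : |v 1| ≤ ‖v‖ := PiLp.norm_apply_le v 1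
  have : fderiv ℝ f x v = v 0 * fderiv ℝ f x (ev 0) + v 1 * fderiv ℝ f x (ev 1) := by
    conv_lhs => rw [hv]
    simp
  rw [this, Real.norm_eq_abs]
  calc _ ≤ |v 0| * |fderiv ℝ f x (ev 0)| + |v 1| * |fderiv ℝ f x (ev 1)| := by
        rw [← abs_mul, ← abs_mul]; exact abs_add_le _ _
    _ ≤ ‖v‖ * |fderiv ℝ f x (ev 0)| + ‖v‖ * |fderiv ℝ f x (ev 1)| := by gcongr
    _ = _ := by ring

end Wav

/-- C¹ bound via Sobolev norms for solutions of the two-dimensional wave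
equation. For every `ρ > 0` there is `C > 0` (depending only on `ρ`) such that: whenever
`T > 0` and `w : ℝ × ℝ² → ℝ` is smooth, satisfies `∂²ₜ w = ∂²_{x₁} w + ∂²_{x₂} w`
everywhere, and for each `t ∈ [0,T]` the spatial support of `w(t,·)` lies in the closed
ball of radius `ρ` about the origin, then for every `t ∈ [0,T]` and every `x`,
`|w(t,x)| + ‖∇ₓ w(t,x)‖ ≤ C · (‖w(0,·)‖_{H³} + ‖∂ₜ w(0,·)‖_{H²})`. -/
theorem stmt11 (ρ : ℝ) (hρ : 0 < ρ) :
    ∃ C > (0 : ℝ), ∀ T : ℝ, 0 < T → ∀ w : ℝ × E2 → ℝ, ContDiff ℝ (⊤ : ℕ∞) w →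
      (∀ (t : ℝ) (x : E2),
        deriv (deriv (fun τ : ℝ => w (τ, x))) t =
          deriv (deriv (fun s : ℝ =>
              w (t, x + s • EuclideanSpace.single (0 : Fin 2) (1 : ℝ)))) 0 +
          deriv (deriv (fun s : ℝ =>
              w (t, x + s • EuclideanSpace.single (1 : Fin 2) (1 : ℝ)))) 0) →
      (∀ t ∈ Set.Icc (0 : ℝ) T,
        Function.support (fun x => w (t, x)) ⊆ Metric.closedBall 0 ρ) →
      ∀ t ∈ Set.Icc (0 : ℝ) T, ∀ x : E2,
        |w (t, x)| + ‖gradient (fun y => w (t, y)) x‖ ≤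
          C * (Real.sqrt (∑ k ∈ Finset.range 4,
                  ∫ y : E2, ‖iteratedFDeriv ℝ k (fun z => w (0, z)) y‖ ^ 2) +
               Real.sqrt (∑ k ∈ Finset.range 3,
                  ∫ y : E2,
                    ‖iteratedFDeriv ℝ k
                        (fun z => deriv (fun τ : ℝ => w (τ, z)) 0) y‖ ^ 2)) := by
  set R := ρ + 1 with hRdef
  have hR : 0 < R := by linarith
  refine ⟨8 * R ^ 2 + 8 * R, by positivity, ?_⟩
  intro T hT w hw hwave hsupp t ht x
  let U : Wav.P3 → ℝ := fun p => w (p 0, !₂[p 1, p 2])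
  have hUw : ∀ (s : ℝ) (z : E2), w (s, z) = U ![s, z 0, z 1] := by
    intro s z
    change w (s, z) = w (s, !₂[z 0, z 1])
    congr 2
    ext i; fin_cases i <;> rfl
  have hU : Wav.Sm U := by
    refine hw.comp (ContDiff.prodMk (contDiff_apply ℝ ℝ (0 : Fin 3)) ?_)
    rw [contDiff_euclidean]
    intro i
    fin_cases i
    · exact contDiff_apply ℝ ℝ (1 : Fin 3)
    · exact contDiff_apply ℝ ℝ (2 : Fin 3)
  have hwt : ∀ (s : ℝ) (z : E2), deriv (fun τ => w (τ, z)) s = Wav.D 0 U ![s, z 0, z 1] := by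
    intro s z
    simp only [hUw]
    exact (Wav.hasDeriv0 hU s _ _).deriv
  have wave0 : ∀ (s : ℝ) (z : E2), Wav.D 0 (Wav.D 0 U) ![s, z 0, z 1] =
      Wav.D 1 (Wav.D 1 U) ![s, z 0, z 1] + Wav.D 2 (Wav.D 2 U) ![s, z 0, z 1] := by
    intro s z
    have h := hwave s z
    have e0 : deriv (fun τ => w (τ, z)) = fun τ => Wav.D 0 U ![τ, z 0, z 1] :=
      funext fun τ => hwt τ z
    rw [e0, (Wav.hasDeriv0 (hU.D 0) s _ _).deriv] at h
    simp only [hUw] at h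
    simp only [PiLp.add_apply, PiLp.smul_apply, EuclideanSpace.single_apply, smul_eq_mul] at h
    norm_num at h
    have d1 : ∀ {G : Wav.P3 → ℝ} (hG : Wav.Sm G) (r : ℝ),
        deriv (fun r : ℝ => G ![s, z 0 + r, z 1]) r = Wav.D 1 G ![s, z 0 + r, z 1] :=
      fun hG r => ((Wav.hasDeriv1 hG s (z 0 + r) (z 1)).comp_const_add (z 0) r).deriv
    have d2 : ∀ {G : Wav.P3 → ℝ} (hG : Wav.Sm G) (r : ℝ),
        deriv (fun r : ℝ => G ![s, z 0, z 1 + r]) r = Wav.D 2 G ![s, z 0, z 1 + r] :=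
      fun hG r => ((Wav.hasDeriv2 hG s (z 0) (z 1 + r)).comp_const_add (z 1) r).deriv
    rw [funext (d1 hU), funext (d2 hU), d1 (hU.D 1), d2 (hU.D 2)] at h
    simpa using h
  have waveU : Wav.D 0 (Wav.D 0 U) = Wav.D 1 (Wav.D 1 U) + Wav.D 2 (Wav.D 2 U) := by
    funext p
    have h := wave0 (p 0) !₂[p 1, p 2]
    have hp : (![p 0, p 1, p 2] : Wav.P3) = p := by ext i; fin_cases i <;> rfl
    simpa [hp] using h
  have hV := (hU.D 2).D 1
  set V := Wav.D 1 (Wav.D 2 U) with hVdef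
  have waveV : Wav.D 0 (Wav.D 0 V) = Wav.D 1 (Wav.D 1 V) + Wav.D 2 (Wav.D 2 V) :=
    Wav.wave_D (hU.D 2) (Wav.wave_D hU waveU 2) 1
  -- vanishing
  have vU : ∀ s ∈ Set.Icc 0 T, ∀ z : E2, ρ < ‖z‖ → U ![s, z 0, z 1] = 0 := by
    intro s hs z hz
    rw [← hUw]
    by_contra hne
    have := hsupp s hs (show z ∈ Function.support (fun x => w (s, x)) from hne)
    rw [mem_closedBall_zero_iff] at this
    linarith
  have v1 := fun s hs => Wav.van hU (vU s hs) 0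
  have v2 := fun s hs => Wav.van hU (vU s hs) 1
  have v11 := fun s hs => Wav.van (hU.D 1) (v1 s hs) 0
  have v12 := fun s hs => Wav.van (hU.D 2) (v2 s hs) 0
  have v112 := fun s hs => Wav.van hV (v12 s hs) 0
  have v212 := fun s hs => Wav.van hV (v12 s hs) 1
  have bd : ∀ a b : ℝ, (|a| = R ∨ |b| = R) → ρ < ‖(!₂[a, b] : E2)‖ := by
    intro a b h
    have b0 : |a| ≤ ‖(!₂[a, b] : E2)‖ := PiLp.norm_apply_le (!₂[a, b] : E2) 0
    have b1 : |b| ≤ ‖(!₂[a, b] : E2)‖ := PiLp.norm_apply_le (!₂[a, b] : E2) 1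
    rcases h with h | h <;> linarith
  -- energy
  have hen := Wav.energy hV (congrFun waveV) hR ht.1 (by
    intro s hs a b h
    have hs' : s ∈ Set.Icc 0 T := ⟨hs.1, hs.2.trans ht.2⟩
    exact ⟨v112 s hs' _ (bd a b h), v212 s hs' _ (bd a b h)⟩)
  -- initial data
  set f0 : E2 → ℝ := fun z => w (0, z) with hf0
  set f1 : E2 → ℝ := fun z => deriv (fun τ : ℝ => w (τ, z)) 0 with hf1
  have hf0' : f0 = fun z : E2 => U ![0, z 0, z 1] := funext fun z => hUw 0 z
  have hf1' : f1 = fun z : E2 => Wav.D 0 U ![0, z 0, z 1] := funext fun z => hwt 0 z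
  have sf0 : ContDiff ℝ (⊤ : ℕ∞) f0 := by rw [hf0']; exact Wav.slice_smooth hU 0
  have sf1 : ContDiff ℝ (⊤ : ℕ∞) f1 := by rw [hf1']; exact Wav.slice_smooth (hU.D 0) 0
  have h0T : (0 : ℝ) ∈ Set.Icc 0 T := ⟨le_rfl, hT.le⟩
  have zf0 : ∀ z : E2, ρ < ‖z‖ → f0 z = 0 := by
    intro z hz; rw [hf0']; exact vU 0 h0T z hz
  have zf1 : ∀ z : E2, ρ < ‖z‖ → f1 z = 0 := by
    intro z hz
    rw [hf1']
    have h1 := (Wav.hasDeriv0 hU 0 (z 0) (z 1)).hasDerivWithinAt (s := Set.Icc 0 T)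
    have h2 : HasDerivWithinAt (fun s => U ![s, z 0, z 1]) 0 (Set.Icc 0 T) 0 :=
      (hasDerivWithinAt_const (0 : ℝ) (Set.Icc 0 T) (0 : ℝ)).congr
        (fun s hs => vU s hs z hz) (vU 0 h0T z hz)
    exact (uniqueDiffOn_Icc hT 0 h0T).eq_deriv _ h1 h2
  have i0 := fun n => Wav.int_it sf0 zf0 n
  have i1 := fun n => Wav.int_it sf1 zf1 n
  set SB := ∑ k ∈ Finset.range 4, ∫ y : E2, ‖iteratedFDeriv ℝ k f0 y‖ ^ 2 with hSB
  set SA := ∑ k ∈ Finset.range 3, ∫ y : E2, ‖iteratedFDeriv ℝ k f1 y‖ ^ 2 with hSA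
  have hB : ∫ y : E2, ‖iteratedFDeriv ℝ 3 f0 y‖ ^ 2 ≤ SB :=
    Finset.single_le_sum (f := fun k => ∫ y : E2, ‖iteratedFDeriv ℝ k f0 y‖ ^ 2)
      (fun k _ => integral_nonneg fun y => by positivity) (by simp)
  have hA : ∫ y : E2, ‖iteratedFDeriv ℝ 2 f1 y‖ ^ 2 ≤ SA :=
    Finset.single_le_sum (f := fun k => ∫ y : E2, ‖iteratedFDeriv ℝ k f1 y‖ ^ 2)
      (fun k _ => integral_nonneg fun y => by positivity) (by simp)
  have hSB0 : 0 ≤ SB := le_trans (integral_nonneg fun y => by positivity) hB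
  have hSA0 : 0 ≤ SA := le_trans (integral_nonneg fun y => by positivity) hA
  have c0 := (hV.D 0).continuous
  have c1 := (hV.D 1).continuous
  have c2 := (hV.D 2).continuous
  have cen : Continuous (Wav.en V) := by unfold Wav.en; fun_prop
  have hE0 : ∫ p in Wav.box R, Wav.en V ![0, p 0, p 1] ≤ SA + 2 * SB := by
    have hle := Wav.box_le (g := fun y => ‖iteratedFDeriv ℝ 2 f1 y‖ ^ 2 +
        2 * ‖iteratedFDeriv ℝ 3 f0 y‖ ^ 2) ((i1 2).add ((i0 3).const_mul 2))
      (fun y => by positivity) (F := fun p => Wav.en V ![0, p 0, p 1]) (by fun_prop) (by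
        intro y
        have q0 : Wav.D 0 V ![0, y 0, y 1] ^ 2 ≤ ‖iteratedFDeriv ℝ 2 f1 y‖ ^ 2 := by
          rw [hf1', hVdef, Wav.D_comm (hU.D 2) 0 1, Wav.D_comm hU 0 2]
          exact Wav.bound2 (hU.D 0) 0 0 1 y
        have q1 : Wav.D 1 V ![0, y 0, y 1] ^ 2 ≤ ‖iteratedFDeriv ℝ 3 f0 y‖ ^ 2 := by
          rw [hf0']
          exact Wav.bound3 hU 0 0 0 1 y
        have q2 : Wav.D 2 V ![0, y 0, y 1] ^ 2 ≤ ‖iteratedFDeriv ℝ 3 f0 y‖ ^ 2 := by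
          rw [hf0']
          exact Wav.bound3 hU 0 1 0 1 y
        simp only [Wav.en]
        linarith) R
    rw [integral_add (i1 2) ((i0 3).const_mul 2), integral_const_mul] at hle
    linarith
  set N := Real.sqrt SB + Real.sqrt SA with hN
  have hN0 : 0 ≤ N := by positivity
  have hE : ∫ p in Wav.box R, Wav.en V ![t, p 0, p 1] ≤ (2 * N) ^ 2 := by
    rw [hen]
    have r1 := Real.sq_sqrt hSB0
    have r2 := Real.sq_sqrt hSA0
    have r3 : 0 ≤ Real.sqrt SB * Real.sqrt SA := by positivity
    rw [hN]
    nlinarith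
  -- gradient bounds
  have part : ∀ H : Wav.P3 → ℝ, Continuous H → (∀ p, H p ^ 2 ≤ Wav.en V p) →
      ∫ p in Wav.box R, H ![t, p 0, p 1] ^ 2 ≤ (2 * N) ^ 2 := by
    intro H hH hle
    refine le_trans ?_ hE
    have k1 : Continuous fun p : Fin 2 → ℝ => H ![t, p 0, p 1] ^ 2 := by fun_prop
    have k2 : Continuous fun p : Fin 2 → ℝ => Wav.en V ![t, p 0, p 1] := by fun_prop
    exact setIntegral_mono (k1.continuousOn.integrableOn_compact isCompact_Icc)
      (k2.continuousOn.integrableOn_compact isCompact_Icc) (fun p => hle _)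
  have g1 : ∀ a ∈ Set.Icc (-R) R, ∀ b ∈ Set.Icc (-R) R, |Wav.D 1 U ![t, a, b]| ≤ 4 * R * N := by
    intro a ha b hb
    have h := Wav.sob2 (hU.D 1) hR
      (fun a b h => ⟨v1 t ht _ (bd a b h), v11 t ht _ (bd a b h)⟩) ha hb
    have e : Wav.D 2 (Wav.D 1 (Wav.D 1 U)) = Wav.D 1 V := by
      rw [Wav.D_comm (hU.D 1) 2 1, Wav.D_comm hU 2 1]
    rw [e] at h
    have h2 := part _ c1 (fun p => by
      simp only [Wav.en]; nlinarith [sq_nonneg (Wav.D 0 V p), sq_nonneg (Wav.D 2 V p)])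
    refine abs_le_of_sq_le_sq (h.trans ?_) (by positivity)
    calc _ ≤ (2 * R) ^ 2 * (2 * N) ^ 2 := by gcongr
      _ = _ := by ring
  have g2 : ∀ a ∈ Set.Icc (-R) R, ∀ b ∈ Set.Icc (-R) R, |Wav.D 2 U ![t, a, b]| ≤ 4 * R * N := by
    intro a ha b hb
    have h := Wav.sob2 (hU.D 2) hR
      (fun a b h => ⟨v2 t ht _ (bd a b h), v12 t ht _ (bd a b h)⟩) ha hb
    have h2 := part _ c2 (fun p => by
      simp only [Wav.en]; nlinarith [sq_nonneg (Wav.D 0 V p), sq_nonneg (Wav.D 1 V p)])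
    refine abs_le_of_sq_le_sq (h.trans ?_) (by positivity)
    calc _ ≤ (2 * R) ^ 2 * (2 * N) ^ 2 := by gcongr
      _ = _ := by ring
  have hg := Wav.grad_le (fun y => w (t, y)) x
  have hfe : (fun y => w (t, y)) = fun y : E2 => U ![t, y 0, y 1] := funext fun y => hUw t y
  have s0 : fderiv ℝ (fun y => w (t, y)) x (Wav.ev 0) = Wav.D 1 U ![t, x 0, x 1] := by
    rw [hfe]; exact Wav.slice hU t x 0
  have s1 : fderiv ℝ (fun y => w (t, y)) x (Wav.ev 1) = Wav.D 2 U ![t, x 0, x 1] := by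
    rw [hfe]; exact Wav.slice hU t x 1
  rw [s0, s1] at hg
  rw [hUw t x]
  by_cases hx : ρ < ‖x‖
  · have a1 : Wav.D 1 U ![t, x 0, x 1] = 0 := v1 t ht x hx
    have a2 : Wav.D 2 U ![t, x 0, x 1] = 0 := v2 t ht x hx
    rw [a1, a2] at hg
    rw [vU t ht x hx]
    have : 0 ≤ (8 * R ^ 2 + 8 * R) * N := by positivity
    simp only [abs_zero] at hg ⊢
    linarith
  · have b0 : |x 0| ≤ ‖x‖ := PiLp.norm_apply_le x 0
    have b1 : |x 1| ≤ ‖x‖ := PiLp.norm_apply_le x 1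
    have m0 : x 0 ∈ Set.Icc (-R) R := abs_le.1 (by linarith)
    have m1 : x 1 ∈ Set.Icc (-R) R := abs_le.1 (by linarith)
    have hRR' : |-R| = R := by rw [abs_neg, abs_of_pos hR]
    have cc1 := (hU.D 1).continuous
    have h := Wav.sob1 (fun s => Wav.hasDeriv1 hU t s (x 1)) (by fun_prop) hR
      (vU t ht _ (bd (-R) (x 1) (Or.inl hRR'))) m0
    have h2 : ∫ s in (-R)..R, Wav.D 1 U ![t, s, x 1] ^ 2 ≤ ∫ s in (-R)..R, (4 * R * N) ^ 2 := by
      apply intervalIntegral.integral_mono_on (by linarith)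
      · exact Continuous.intervalIntegrable (by fun_prop) _ _
      · simp
      · intro s hs
        exact sq_le_sq' (abs_le.1 (g1 s hs _ m1)).1 (abs_le.1 (g1 s hs _ m1)).2
    have h3 : |U ![t, x 0, x 1]| ≤ 2 * R * (4 * R * N) := by
      refine abs_le_of_sq_le_sq (h.trans ?_) (by positivity)
      calc _ ≤ 2 * R * ∫ s in (-R)..R, (4 * R * N) ^ 2 := by gcongr
        _ = _ := by simp; ring
    have h4 := g1 _ m0 _ m1
    have h5 := g2 _ m0 _ m1
    linarith
end
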